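/- Let l, m, n, u, v be nonnegative integers. Then Σ_{k=−∞}^{∞} (−1)^k · C(l+m, l+k) · C(m+n, m+k) · C(n+l, n+k) · C(u+v, u+k) · C(u+v, v+k) = C(u+v, u) · Σ_{k=0}^{min(l,m,n)} (l+m+n−k)! (u+v+k)! / [k! (l−k)! (m−k)! (n−k)! (u+k)! (v+k)!], as an identity of rational numbers; the left-hand sum is finite since C(a, b) = 0 unless 0 ≤ b ≤ a. -/

import Mathlib

/-- The binomial coefficient `C(a, b)` with an integer lower index,
equal to `0` when `b < 0` (and, via `Nat.choose`, also when `b > a`). -/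
def intChoose (a : ℕ) (b : ℤ) : ℕ := if 0 ≤ b then a.choose b.toNat else 0

/-- The reciprocal factorial `1 / x!` on the integers, equal to `0` at negative integers. -/
def invFactorial (x : ℤ) : ℚ := if 0 ≤ x then ((x.toNat.factorial : ℕ) : ℚ)⁻¹ else 0

lemma invFactorial_of_neg {x : ℤ} (hx : x < 0) : invFactorial x = 0 := by
  simp [invFactorial, hx]

lemma invFactorial_natCast (x : ℕ) : invFactorial x = ((x.factorial : ℕ) : ℚ)⁻¹ := by
  simp [invFactorial]

lemma mul_invFactorial (x : ℤ) : (x : ℚ) * invFactorial x = invFactorial (x - 1) := by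
  rcases lt_trichotomy x 0 with hx | rfl | hx
  · rw [invFactorial_of_neg hx, invFactorial_of_neg (by omega), mul_zero]
  · rw [invFactorial_of_neg (by omega : (0 : ℤ) - 1 < 0)]
    simp
  · obtain ⟨y, rfl⟩ : ∃ y : ℕ, x = (y : ℤ) + 1 := ⟨(x - 1).toNat, by omega⟩
    rw [add_sub_cancel_right, invFactorial_natCast, ← Nat.cast_succ, invFactorial_natCast,
      Nat.factorial_succ]
    push_cast
    have : (y : ℚ) + 1 ≠ 0 := by positivity
    have := Nat.factorial_ne_zero y
    field_simp

lemma factorial_mul_invFactorial (x : ℕ) : (x.factorial : ℚ) * invFactorial x = 1 := by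
  rw [invFactorial_natCast]
  exact mul_inv_cancel₀ (by exact_mod_cast Nat.factorial_ne_zero x)

lemma intChoose_eq (a b : ℕ) (k : ℤ) :
    (intChoose (a + b) (a + k) : ℚ) =
      (a + b).factorial * (invFactorial (a + k) * invFactorial (b - k)) := by
  unfold intChoose
  split_ifs with h
  · obtain ⟨y, hy⟩ := Int.eq_ofNat_of_zero_le h
    rw [hy]
    by_cases hb : 0 ≤ (b : ℤ) - k
    · obtain ⟨z, hz⟩ := Int.eq_ofNat_of_zero_le hb
      have hab : a + b = y + z := by omega
      rw [hz, invFactorial_natCast, invFactorial_natCast, hab, Int.toNat_natCast,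
        Nat.cast_add_choose]
      field_simp
    · rw [invFactorial_of_neg (by omega : (b : ℤ) - k < 0), Int.toNat_natCast,
        Nat.choose_eq_zero_of_lt (by omega)]
      simp
  · rw [invFactorial_of_neg (by omega : (a : ℤ) + k < 0)]
    simp

/-- The summand of `sum_tripleTerm`. -/
def tripleTerm (l m n : ℕ) (k : ℤ) (j : ℕ) : ℚ :=
  (l + m + n - j).factorial * (invFactorial (j - k) * invFactorial (j + k) *
    invFactorial (l - j) * invFactorial (m - j) * invFactorial (n - j))

lemma tripleTerm_eq_zero {l m n j : ℕ} {k : ℤ} (h : j < k.natAbs ∨ l < j ∨ m < j ∨ n < j) :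
    tripleTerm l m n k j = 0 := by
  unfold tripleTerm
  rcases h with h | h | h | h
  · rcases (by omega : (j : ℤ) < k ∨ (j : ℤ) < -k) with h | h
    · rw [invFactorial_of_neg (by omega : (j : ℤ) - k < 0)]; simp
    · rw [invFactorial_of_neg (by omega : (j : ℤ) + k < 0)]; simp
  · rw [invFactorial_of_neg (by omega : (l : ℤ) - j < 0)]; simp
  · rw [invFactorial_of_neg (by omega : (m : ℤ) - j < 0)]; simp
  · rw [invFactorial_of_neg (by omega : (n : ℤ) - j < 0)]; simp

lemma invFactorial_add_mul_sub_eq_zero {a : ℕ} {k : ℤ} (h : a < k.natAbs) :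
    invFactorial (a + k) * invFactorial (a - k) = 0 := by
  rcases (by omega : (a : ℤ) < k ∨ (a : ℤ) < -k) with h | h
  · rw [invFactorial_of_neg (by omega : (a : ℤ) - k < 0), mul_zero]
  · rw [invFactorial_of_neg (by omega : (a : ℤ) + k < 0), zero_mul]

/-- A telescoping relation satisfied by the summands `tripleTerm`. -/
lemma tripleTerm_telescope {l m n j : ℕ} (k : ℤ) (hj : j ≤ l) :
    ((n + 1 : ℚ) - k) * (n + 1 + k) * tripleTerm l m (n + 1) k j -
        (m + n + 1) * (n + l + 1) * tripleTerm l m n k j =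
      -(((j + 1 : ℕ) : ℚ) - k) * (((j + 1 : ℕ) : ℚ) + k) * tripleTerm l m (n + 1) k (j + 1) -
      -((j : ℚ) - k) * (j + k) * tripleTerm l m (n + 1) k j := by
  obtain ⟨d, rfl⟩ := Nat.exists_eq_add_of_le hj
  unfold tripleTerm
  have e₁ : j + d + m + (n + 1) - j = d + m + n + 1 := by omega
  have e₂ : j + d + m + n - j = d + m + n := by omega
  have e₃ : j + d + m + (n + 1) - (j + 1) = d + m + n := by omega
  rw [e₁, e₂, e₃, Nat.factorial_succ]
  have h₁ := mul_invFactorial (((j + 1 : ℕ) : ℤ) - k)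
  have h₂ := mul_invFactorial (((j + 1 : ℕ) : ℤ) + k)
  have h₃ := mul_invFactorial (((j + d : ℕ) : ℤ) - j)
  have h₄ := mul_invFactorial ((m : ℤ) - j)
  have h₅ := mul_invFactorial (((n + 1 : ℕ) : ℤ) - j)
  rw [show ((j + 1 : ℕ) : ℤ) - k - 1 = j - k by push_cast; ring] at h₁
  rw [show ((j + 1 : ℕ) : ℤ) + k - 1 = j + k by push_cast; ring] at h₂
  rw [show ((j + d : ℕ) : ℤ) - j - 1 = ((j + d : ℕ) : ℤ) - ((j + 1 : ℕ) : ℤ) by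
    push_cast; ring] at h₃
  rw [show (m : ℤ) - j - 1 = m - ((j + 1 : ℕ) : ℤ) by push_cast; ring] at h₄
  rw [show ((n + 1 : ℕ) : ℤ) - j - 1 = n - j by push_cast; ring] at h₅
  rw [show ((n + 1 : ℕ) : ℤ) - ((j + 1 : ℕ) : ℤ) = n - j by push_cast; ring,
    ← h₁, ← h₂, ← h₃, ← h₄, ← h₅]
  push_cast
  ring

lemma sum_tripleTerm (l m n : ℕ) (k : ℤ) :
    ∑ j ∈ Finset.range (l + 1), tripleTerm l m n k j =
      (l + m).factorial * (m + n).factorial * (n + l).factorial *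
        (invFactorial (l + k) * invFactorial (l - k) * (invFactorial (m + k) *
          invFactorial (m - k)) * (invFactorial (n + k) * invFactorial (n - k))) := by
  rcases lt_or_ge n k.natAbs with hn | hn
  · rw [invFactorial_add_mul_sub_eq_zero (a := n) (by omega)]
    simp only [mul_zero]
    refine Finset.sum_eq_zero fun j _ => tripleTerm_eq_zero ?_
    omega
  induction n, hn using Nat.le_induction with
  | base =>
    set a := k.natAbs with ha
    rw [Finset.sum_eq_single a]
    · by_cases hl : (a : ℤ) ≤ l
      · by_cases hm : (a : ℤ) ≤ m
        · have hsymm : ∀ x : ℤ, invFactorial (x + k) * invFactorial (x - k) =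
              invFactorial (x + a) * invFactorial (x - a) := by
            intro x
            rcases Int.natAbs_eq k with h | h
            · rw [h, ← ha]
            · rw [h, ← ha, sub_neg_eq_add, ← sub_eq_add_neg, mul_comm]
          unfold tripleTerm
          rw [Nat.add_sub_cancel, mul_comm (invFactorial (a - k)), hsymm, hsymm, hsymm]
          have h₁ := factorial_mul_invFactorial (m + a)
          have h₂ := factorial_mul_invFactorial (a + l)
          push_cast at h₁ h₂
          rw [add_comm (a : ℤ) l] at h₂
          have h₃ : invFactorial ((a : ℤ) - a) = 1 := by simp [invFactorial]
          rw [h₃]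
          linear_combination (-((l + m).factorial : ℚ) * invFactorial (a + a) *
            invFactorial (l - a) * invFactorial (m - a)) *
            (h₁ * ((a + l).factorial * invFactorial (l + a)) + h₂)
        · rw [tripleTerm_eq_zero (by omega), invFactorial_add_mul_sub_eq_zero (a := m) (by omega)]
          simp
      · rw [tripleTerm_eq_zero (by omega), invFactorial_add_mul_sub_eq_zero (a := l) (by omega)]
        simp
    · intro j _ hj
      exact tripleTerm_eq_zero (by omega)
    · intro hl
      rw [Finset.mem_range] at hl
      exact tripleTerm_eq_zero (by omega)
  | succ n hn ih =>
    have hsum := Finset.sum_congr rfl fun j (hj : j ∈ Finset.range (l + 1)) =>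
      tripleTerm_telescope (m := m) (n := n) k (Nat.lt_succ_iff.1 (Finset.mem_range.1 hj))
    rw [Finset.sum_range_sub (fun j : ℕ => -((j : ℚ) - k) * (j + k) *
        tripleTerm l m (n + 1) k j), Finset.sum_sub_distrib, ← Finset.mul_sum, ← Finset.mul_sum,
      ih, tripleTerm_eq_zero (j := l + 1) (by omega)] at hsum
    have h0 : -(((0 : ℕ) : ℚ) - k) * (((0 : ℕ) : ℚ) + k) * tripleTerm l m (n + 1) k 0 = 0 := by
      by_cases hk : k = 0
      · simp [hk]
      · rw [tripleTerm_eq_zero (by omega), mul_zero]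
    rw [h0] at hsum
    have h₁ : (n + 1 : ℚ) - k ≠ 0 := by
      have : (n + 1 : ℤ) - k ≠ 0 := by omega
      exact_mod_cast this
    have h₂ : (n + 1 : ℚ) + k ≠ 0 := by
      have : (n + 1 : ℤ) + k ≠ 0 := by omega
      exact_mod_cast this
    refine mul_left_cancel₀ (mul_ne_zero h₁ h₂) ?_
    have h₃ := mul_invFactorial (((n + 1 : ℕ) : ℤ) - k)
    have h₄ := mul_invFactorial (((n + 1 : ℕ) : ℤ) + k)
    rw [show ((n + 1 : ℕ) : ℤ) - k - 1 = n - k by push_cast; ring] at h₃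
    rw [show ((n + 1 : ℕ) : ℤ) + k - 1 = n + k by push_cast; ring] at h₄
    rw [← h₃, ← h₄] at hsum
    rw [show m + (n + 1) = m + n + 1 by ring, show n + 1 + l = n + l + 1 by ring,
      Nat.factorial_succ, Nat.factorial_succ]
    push_cast at hsum ⊢
    linear_combination hsum

lemma alternating_sum_invFactorial {N j : ℕ} (h : j ≤ N) :
    ∑ k ∈ Finset.Ico (-(N : ℤ)) (N + 1), (-1 : ℚ) ^ k * (invFactorial (j - k) *
      invFactorial (j + k)) = if j = 0 then 1 else 0 := by
  split_ifs with hj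
  · subst hj
    rw [Finset.sum_eq_single 0]
    · simp [invFactorial]
    · intro k _ hk
      have := invFactorial_add_mul_sub_eq_zero (a := 0) (k := k) (by omega)
      rw [mul_comm (invFactorial _), this, mul_zero]
    · intro hk
      exact absurd (Finset.mem_Ico.2 ⟨by omega, by omega⟩) hk
  · have htele : ∀ (F : ℤ → ℚ) (M : ℕ), ∑ k ∈ Finset.Ico (-(M : ℤ)) (M + 1),
        (F k - F (k - 1)) = F M - F (-M - 1) := by
      intro F M
      have hrange : Finset.Ico (-(M : ℤ)) (M + 1) =
          (Finset.range (2 * M + 1)).image fun i : ℕ => (i : ℤ) - M := by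
        ext k
        simp only [Finset.mem_Ico, Finset.mem_image, Finset.mem_range]
        exact ⟨fun hk => ⟨(k + M).toNat, by omega, by omega⟩, by rintro ⟨i, hi, rfl⟩; omega⟩
      rw [hrange, Finset.sum_image (by intro x _ y _ hxy; simpa using hxy)]
      have := Finset.sum_range_sub (fun i : ℕ => F ((i : ℤ) - M - 1)) (2 * M + 1)
      convert this using 2
      · congr 2
        push_cast
        ring
      · push_cast
        congr 1
        ring
      · simp
    have hj' : (2 * j : ℚ) ≠ 0 := by positivity
    refine (mul_eq_zero.1 ?_).resolve_left hj'
    have h₁ := htele (fun k => (-1 : ℚ) ^ k * (invFactorial (j - k - 1) *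
      invFactorial (j + k))) N
    rw [invFactorial_of_neg (by omega : (j : ℤ) - N - 1 < 0),
      invFactorial_of_neg (by omega : (j : ℤ) + (-N - 1) < 0)] at h₁
    simp only [mul_zero, zero_mul, sub_self] at h₁
    rw [← h₁, Finset.mul_sum]
    refine Finset.sum_congr rfl fun k _ => ?_
    have h₂ := mul_invFactorial (j - k)
    have h₃ := mul_invFactorial (j + k)
    rw [show (j : ℤ) - (k - 1) - 1 = j - k by ring, show (j : ℤ) + (k - 1) = j + k - 1 by ring,
      ← h₂, ← h₃, zpow_sub_one₀ (by norm_num)]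
    push_cast
    ring

/-- Dixon's identity. -/
lemma dixon_sum {N a : ℕ} (b c : ℕ) (h : a ≤ N) :
    ∑ k ∈ Finset.Ico (-(N : ℤ)) (N + 1), (-1 : ℚ) ^ k *
      (invFactorial (a + k) * invFactorial (a - k) * (invFactorial (b + k) *
          invFactorial (b - k)) * (invFactorial (c + k) * invFactorial (c - k))) =
      (a + b + c).factorial / (a.factorial * b.factorial * c.factorial * (a + b).factorial *
        (b + c).factorial * (c + a).factorial) := by
  have hne : ((a + b).factorial : ℚ) * (b + c).factorial * (c + a).factorial ≠ 0 := by
    positivity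
  refine mul_left_cancel₀ hne ?_
  rw [Finset.mul_sum]
  trans ∑ k ∈ Finset.Ico (-(N : ℤ)) (N + 1), ∑ j ∈ Finset.range (a + 1),
    (-1 : ℚ) ^ k * tripleTerm a b c k j
  · refine Finset.sum_congr rfl fun k _ => ?_
    rw [← Finset.mul_sum, sum_tripleTerm]
    ring
  rw [Finset.sum_comm]
  trans ∑ j ∈ Finset.range (a + 1), (a + b + c - j).factorial * (invFactorial (a - j) *
    invFactorial (b - j) * invFactorial (c - j)) * (if j = 0 then (1 : ℚ) else 0)
  · refine Finset.sum_congr rfl fun j hj => ?_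
    rw [← alternating_sum_invFactorial (N := N) (j := j)
      (by have := Finset.mem_range.1 hj; omega), Finset.mul_sum]
    refine Finset.sum_congr rfl fun k _ => ?_
    unfold tripleTerm
    ring
  · rw [Finset.sum_eq_single 0 (by intro j _ hj; simp [hj]) (by simp)]
    simp only [Nat.sub_zero, Nat.cast_zero, sub_zero, if_true, invFactorial_natCast]
    field_simp

theorem stmt18 (l m n u v : ℕ) :
    (∑' k : ℤ, ((-1 : ℚ) ^ k *
      (intChoose (l + m) ((l : ℤ) + k)) * (intChoose (m + n) ((m : ℤ) + k)) *
      (intChoose (n + l) ((n : ℤ) + k)) * (intChoose (u + v) ((u : ℤ) + k)) *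
      (intChoose (u + v) ((v : ℤ) + k)))) =
    ((u + v).choose u : ℚ) * ∑ k ∈ Finset.range (min l (min m n) + 1),
      ((Nat.factorial (l + m + n - k) * Nat.factorial (u + v + k) : ℕ) : ℚ) /
        ((Nat.factorial k * Nat.factorial (l - k) * Nat.factorial (m - k) *
          Nat.factorial (n - k) * Nat.factorial (u + k) * Nat.factorial (v + k) : ℕ) : ℚ) := by
  have hterm : ∀ k : ℤ, (-1 : ℚ) ^ k *
      (intChoose (l + m) ((l : ℤ) + k)) * (intChoose (m + n) ((m : ℤ) + k)) *
      (intChoose (n + l) ((n : ℤ) + k)) * (intChoose (u + v) ((u : ℤ) + k)) *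
      (intChoose (u + v) ((v : ℤ) + k)) =
      ((u + v).factorial : ℚ) ^ 2 * ((invFactorial (u + k) * invFactorial (u - k)) *
        (invFactorial (v + k) * invFactorial (v - k))) * ((-1 : ℚ) ^ k *
      ((l + m).factorial * (m + n).factorial * (n + l).factorial *
        (invFactorial (l + k) * invFactorial (l - k) * (invFactorial (m + k) *
          invFactorial (m - k)) * (invFactorial (n + k) * invFactorial (n - k))))) := by
    intro k
    have huv := intChoose_eq v u k
    rw [add_comm v u] at huv
    rw [intChoose_eq, intChoose_eq, intChoose_eq, intChoose_eq, huv]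
    ring
  simp only [hterm]
  rw [tsum_eq_sum (s := Finset.Ico (-(l : ℤ)) (l + 1))]
  swap
  · intro k hk
    rw [Finset.mem_Ico] at hk
    rw [invFactorial_add_mul_sub_eq_zero (a := l) (by omega)]
    simp
  simp only [← sum_tripleTerm, Finset.mul_sum]
  rw [Finset.sum_comm]
  symm
  trans ∑ j ∈ Finset.range (l + 1), ((u + v).factorial : ℚ) ^ 2 * ((l + m + n - j).factorial *
    (invFactorial (l - j) * invFactorial (m - j) * invFactorial (n - j))) *
    ((j + u + v).factorial / (j.factorial * u.factorial * v.factorial * (j + u).factorial *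
        (u + v).factorial * (v + j).factorial))
  · refine Finset.sum_subset_zero_on_sdiff (fun j hj => ?_) (fun j hj => ?_) fun j hj => ?_
    · rw [Finset.mem_range] at *
      omega
    · rw [Finset.mem_sdiff, Finset.mem_range, Finset.mem_range] at hj
      rcases (by omega : m < j ∨ n < j) with h | h
      · rw [invFactorial_of_neg (by omega : (m : ℤ) - j < 0)]; simp
      · rw [invFactorial_of_neg (by omega : (n : ℤ) - j < 0)]; simp
    · rw [Finset.mem_range] at hj
      rw [← Nat.cast_sub (by omega : j ≤ l), ← Nat.cast_sub (by omega : j ≤ m),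
        ← Nat.cast_sub (by omega : j ≤ n), invFactorial_natCast, invFactorial_natCast,
        invFactorial_natCast, Nat.cast_add_choose, show j + u + v = u + v + j by ring,
        add_comm j u]
      push_cast
      field_simp
  · refine Finset.sum_congr rfl fun j hj => ?_
    rw [← dixon_sum (N := l) u v (by have := Finset.mem_range.1 hj; omega), Finset.mul_sum]
    refine Finset.sum_congr rfl fun k _ => ?_
    unfold tripleTerm
    ring
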